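/- Let n ≥ 1, let σ₁,…,σₙ and τ₁,…,τₙ be positive reals, let q₁, q₂ be nonzero real numbers, and let c₁,…,cₙ be real numbers. Let f : ℝⁿ → ℂ be continuously differentiable, bounded, with bounded first-order partial derivatives, and with f and every ∂ⱼf in L¹(ℝⁿ); let g : ℝⁿ → ℂ be continuously differentiable with g and every ∂ⱼg in L¹(ℝⁿ). Write G̃ = Ψ_{q₁} g, where (Ψ_{q₁} g)(y) = (∏_{j=1}^n (−iq₁/(2πτⱼ²))^{1/2}) ∫_{ℝⁿ} g(u)·exp((iq₁/2) ∑_{j=1}^n (uⱼ−yⱼ)²/τⱼ²) du. Assume in addition that for each j the function u ↦ uⱼ·f(u)·G̃(u) is Lebesgue integrable on ℝⁿ. Then ∑_{j=1}^n cⱼ ∫_{ℝⁿ} [f(u)·∂ⱼG̃(u) + ∂ⱼf(u)·G̃(u)]·E_{q₂}(u) du = −iq₂ ∑_{j=1}^n (cⱼ/σⱼ²) ∫_{ℝⁿ} uⱼ·f(u)·G̃(u)·E_{q₂}(u) du, where E_{q₂}(u) = exp((iq₂/2) ∑_{k=1}^n u_k²/σ_k²), and all integrals converge absolutely. -/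

import Mathlib

open MeasureTheory Real Complex Filter
open scoped ENNReal NNReal Topology

/-- The finite-dimensional generalized Fourier–Feynman (Fresnel) transform
`(Ψ_q g)(y) = (∏ⱼ (−iq/(2πτⱼ²))^{1/2}) ∫ g(u) exp((iq/2) ∑ (uⱼ−yⱼ)²/τⱼ²) du`,
with principal square roots. -/
noncomputable def fresnelTransform (n : ℕ) (τ : Fin n → ℝ) (q : ℝ)
    (g : (Fin n → ℝ) → ℂ) (y : Fin n → ℝ) : ℂ :=
  (∏ j, (-Complex.I * q / (2 * Real.pi * (τ j) ^ 2)) ^ ((1 : ℂ) / 2)) *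
    ∫ u : Fin n → ℝ,
      g u * Complex.exp (Complex.I * q / 2 * (∑ j, (u j - y j) ^ 2 / (τ j) ^ 2 : ℝ))

/-- The quadratic phase. -/
noncomputable def qphase {n : ℕ} (q : ℝ) (s : Fin n → ℝ) (u : Fin n → ℝ) : ℂ :=
  Complex.exp (Complex.I * q / 2 * (∑ k, (u k) ^ 2 / (s k) ^ 2 : ℝ))

lemma qphase_norm {n : ℕ} (q : ℝ) (s u : Fin n → ℝ) : ‖qphase q s u‖ = 1 := by
  unfold qphase
  have : Complex.I * q / 2 * (∑ k, (u k) ^ 2 / (s k) ^ 2 : ℝ)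
      = ((q / 2 * ∑ k, (u k) ^ 2 / (s k) ^ 2 : ℝ) : ℂ) * Complex.I := by
    push_cast; ring
  rw [this, Complex.norm_exp_ofReal_mul_I]

lemma qphase_hasFDerivAt {n : ℕ} (q : ℝ) (s u : Fin n → ℝ) :
    HasFDerivAt (qphase q s)
      (qphase q s u • ((Complex.I * q / 2) •
        (Complex.ofRealCLM.comp (∑ k, (2 * u k / (s k) ^ 2) •
          (ContinuousLinearMap.proj k : (Fin n → ℝ) →L[ℝ] ℝ))))) u := by
  have h1 : HasFDerivAt (fun u : Fin n → ℝ => ∑ k, (u k) ^ 2 / (s k) ^ 2)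
      (∑ k, (2 * u k / (s k) ^ 2) • (ContinuousLinearMap.proj k : (Fin n → ℝ) →L[ℝ] ℝ)) u := by
    apply HasFDerivAt.fun_sum
    intro k _
    have h0 : HasFDerivAt (fun u : Fin n → ℝ => u k)
      (ContinuousLinearMap.proj k : (Fin n → ℝ) →L[ℝ] ℝ) u := hasFDerivAt_apply k u
    have := (h0.pow 2).mul_const (((s k) ^ 2)⁻¹)
    simp only [div_eq_mul_inv]
    refine this.congr_fderiv ?_
    ext v
    simp
    ring
  have h2 := (Complex.ofRealCLM.hasFDerivAt.comp u h1).const_mul (Complex.I * q / 2)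
  exact h2.cexp

lemma qphase_differentiable {n : ℕ} (q : ℝ) (s : Fin n → ℝ) :
    Differentiable ℝ (qphase q s) := fun u => (qphase_hasFDerivAt q s u).differentiableAt

lemma qphase_continuous {n : ℕ} (q : ℝ) (s : Fin n → ℝ) : Continuous (qphase q s) :=
  (qphase_differentiable q s).continuous

lemma qphase_fderiv {n : ℕ} (q : ℝ) (s u : Fin n → ℝ) (j : Fin n) :
    fderiv ℝ (qphase q s) u (Pi.single j 1)
      = Complex.I * q * ((1 / (s j) ^ 2 : ℝ) : ℂ) * u j * qphase q s u := by
  rw [(qphase_hasFDerivAt q s u).fderiv]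
  simp [Pi.single_apply]
  ring

section conv
variable {n : ℕ} {W : Type*} [NormedAddCommGroup W] [NormedSpace ℂ W]

/-- Convolution type transform. -/
noncomputable def ctr (K : (Fin n → ℝ) → ℂ) (k : (Fin n → ℝ) → W) (y : Fin n → ℝ) : W :=
  ∫ u, K (u - y) • k u

lemma ctr_eq (K : (Fin n → ℝ) → ℂ) (k : (Fin n → ℝ) → W) (y : Fin n → ℝ) :
    ctr K k y = ∫ v, K v • k (v + y) := by
  unfold ctr
  rw [← integral_add_right_eq_self (fun u => K (u - y) • k u) y]
  simp

lemma ctr_bound {K : (Fin n → ℝ) → ℂ} (hK1 : ∀ u, ‖K u‖ = 1)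
    (k : (Fin n → ℝ) → W) (y : Fin n → ℝ) : ‖ctr K k y‖ ≤ ∫ u, ‖k u‖ := by
  unfold ctr
  refine (norm_integral_le_integral_norm _).trans_eq ?_
  simp [norm_smul, hK1]

lemma ctr_cont {K : (Fin n → ℝ) → ℂ} (hK : Continuous K) (hK1 : ∀ u, ‖K u‖ = 1)
    {k : (Fin n → ℝ) → W} (hk : Integrable k) : Continuous (ctr K k) := by
  unfold ctr
  refine continuous_of_dominated (bound := fun u => ‖k u‖) ?_ ?_ hk.norm ?_
  · intro y
    exact (hK.comp (continuous_id.sub continuous_const)).aestronglyMeasurable.smul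
      hk.aestronglyMeasurable
  · intro y
    exact Eventually.of_forall fun u => by simp [norm_smul, hK1]
  · exact Eventually.of_forall fun u => by fun_prop

lemma ctr_integrable {K : (Fin n → ℝ) → ℂ} (hK : Continuous K) (hK1 : ∀ u, ‖K u‖ = 1)
    {k : (Fin n → ℝ) → W} (hk : Integrable k) (y : Fin n → ℝ) :
    Integrable (fun v => K v • k (v + y)) := by
  have h := hk.comp_add_right y
  refine h.norm.mono' (hK.aestronglyMeasurable.smul h.aestronglyMeasurable) ?_
  exact Eventually.of_forall fun u => by simp [norm_smul, hK1]

end conv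

lemma ctr_increment {n : ℕ} {K : (Fin n → ℝ) → ℂ} (hK : Continuous K) (hK1 : ∀ u, ‖K u‖ = 1)
    {g : (Fin n → ℝ) → ℂ} (hg : ContDiff ℝ 1 g) (hg1 : Integrable g)
    (hD : Integrable (fderiv ℝ g)) (y h : Fin n → ℝ) :
    ctr K g (y + h) - ctr K g y = ∫ s in (0:ℝ)..1, ctr K (fderiv ℝ g) (y + s • h) h := by
  have hDc : Continuous (fderiv ℝ g) := hg.continuous_fderiv one_ne_zero
  have ftc : ∀ v : Fin n → ℝ, g (v + (y + h)) - g (v + y)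
      = ∫ s in (0:ℝ)..1, fderiv ℝ g (v + (y + s • h)) h := by
    intro v
    have hd : ∀ s : ℝ, HasDerivAt (fun s : ℝ => g (v + (y + s • h)))
        (fderiv ℝ g (v + (y + s • h)) h) s := by
      intro s
      have h1 : HasDerivAt (fun s : ℝ => v + (y + s • h)) h s := by
        have := (((hasDerivAt_id s).smul_const h).const_add y).const_add v
        simpa using this
      exact ((hg.differentiable one_ne_zero _).hasFDerivAt).comp_hasDerivAt s h1
    rw [intervalIntegral.integral_eq_sub_of_hasDerivAt (fun s _ => hd s)]
    · simp
    · apply Continuous.intervalIntegrable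
      fun_prop
  have hKD : ∀ z : Fin n → ℝ, Integrable (fun v => K v • fderiv ℝ g (v + z)) :=
    fun z => ctr_integrable hK hK1 hD z
  have hprod : Integrable (Function.uncurry
      fun (v : Fin n → ℝ) (s : ℝ) => K v * fderiv ℝ g (v + (y + s • h)) h)
      ((volume : Measure (Fin n → ℝ)).prod (volume.restrict (Set.Ioc (0:ℝ) 1))) := by
    have hm : Continuous (Function.uncurry
      fun (v : Fin n → ℝ) (s : ℝ) => K v * fderiv ℝ g (v + (y + s • h)) h) := by
      unfold Function.uncurry
      fun_prop
    rw [integrable_prod_iff' hm.aestronglyMeasurable]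
    constructor
    · refine Eventually.of_forall fun s => ?_
      have := (hKD (y + s • h)).apply_continuousLinearMap h
      simpa [Function.uncurry] using this
    · have : ∀ s : ℝ, ∫ v, ‖Function.uncurry
          (fun (v : Fin n → ℝ) (s : ℝ) => K v * fderiv ℝ g (v + (y + s • h)) h) (v, s)‖
          = ∫ v, ‖fderiv ℝ g v h‖ := by
        intro s
        rw [← integral_add_right_eq_self (fun v => ‖fderiv ℝ g v h‖) (y + s • h)]
        simp [Function.uncurry, hK1]
      simp only [this]
      exact integrable_const _
  rw [ctr_eq, ctr_eq, ← integral_sub (ctr_integrable hK hK1 hg1 _) (ctr_integrable hK hK1 hg1 _)]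
  have e1 : ∀ v : Fin n → ℝ, K v • g (v + (y + h)) - K v • g (v + y)
      = ∫ s in Set.Ioc (0:ℝ) 1, K v * fderiv ℝ g (v + (y + s • h)) h := by
    intro v
    rw [← smul_sub, ftc, intervalIntegral.integral_of_le zero_le_one, integral_const_mul,
      smul_eq_mul]
  simp only [e1]
  rw [integral_integral_swap hprod, intervalIntegral.integral_of_le zero_le_one]
  congr 1
  ext s
  rw [ctr_eq, ContinuousLinearMap.integral_apply (hKD _)]
  simp

lemma ctr_hasFDerivAt {n : ℕ} {K : (Fin n → ℝ) → ℂ} (hK : Continuous K) (hK1 : ∀ u, ‖K u‖ = 1)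
    {g : (Fin n → ℝ) → ℂ} (hg : ContDiff ℝ 1 g) (hg1 : Integrable g)
    (hD : Integrable (fderiv ℝ g)) (y : Fin n → ℝ) :
    HasFDerivAt (ctr K g) (ctr K (fderiv ℝ g) y) y := by
  have hc : Continuous (ctr K (fderiv ℝ g)) := ctr_cont hK hK1 hD
  rw [hasFDerivAt_iff_isLittleO_nhds_zero, Asymptotics.isLittleO_iff]
  intro ε hε
  obtain ⟨δ, hδ, hb⟩ := Metric.continuous_iff.1 hc y ε hε
  filter_upwards [Metric.ball_mem_nhds (0 : Fin n → ℝ) hδ] with h hh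
  rw [mem_ball_zero_iff] at hh
  rw [ctr_increment hK hK1 hg hg1 hD]
  have e : ctr K (fderiv ℝ g) y h = ∫ s in (0:ℝ)..1, ctr K (fderiv ℝ g) y h := by simp
  rw [e, ← intervalIntegral.integral_sub]
  · have := intervalIntegral.norm_integral_le_of_norm_le_const (a := 0) (b := 1) (C := ε * ‖h‖)
      (f := fun s : ℝ => ctr K (fderiv ℝ g) (y + s • h) h - ctr K (fderiv ℝ g) y h) ?_
    · simpa using this
    · intro s hs
      rw [Set.uIoc_of_le zero_le_one] at hs
      rw [← sub_apply]
      refine (ContinuousLinearMap.le_opNorm _ _).trans ?_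
      gcongr
      rw [← dist_eq_norm]
      refine (hb _ ?_).le
      rw [dist_eq_norm, add_sub_cancel_left, norm_smul, Real.norm_of_nonneg hs.1.le]
      nlinarith [norm_nonneg h, hs.2]
  · apply Continuous.intervalIntegrable
    fun_prop
  · simp

lemma fresnel_eq {n : ℕ} (τ : Fin n → ℝ) (q : ℝ) (g : (Fin n → ℝ) → ℂ) :
    fresnelTransform n τ q g = fun y =>
      (∏ j, (-Complex.I * q / (2 * Real.pi * (τ j) ^ 2)) ^ ((1 : ℂ) / 2)) *
        ctr (qphase q τ) g y := by
  ext y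
  simp only [fresnelTransform, ctr, qphase, smul_eq_mul, Pi.sub_apply]
  congr 1
  congr 1
  ext u
  rw [mul_comm]

lemma integrable_fderiv_of_partials {n : ℕ} {g : (Fin n → ℝ) → ℂ} (hg : ContDiff ℝ 1 g)
    (hdg1 : ∀ j : Fin n,
      Integrable (fun u : Fin n → ℝ => fderiv ℝ g u (Pi.single j 1)) volume) :
    Integrable (fderiv ℝ g) := by
  have hs : Integrable (fun u : Fin n → ℝ => ∑ j, ‖fderiv ℝ g u (Pi.single j 1)‖) :=
    integrable_finsetSum _ fun j _ => (hdg1 j).norm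
  refine hs.mono' (hg.continuous_fderiv one_ne_zero).aestronglyMeasurable
    (Eventually.of_forall fun u => ?_)
  refine ContinuousLinearMap.opNorm_le_bound _ (Finset.sum_nonneg fun j _ => norm_nonneg _) ?_
  intro v
  have e : fderiv ℝ g u v = ∑ j, v j • fderiv ℝ g u (Pi.single j 1) := by
    conv_lhs => rw [pi_eq_sum_univ' v]
    simp [map_sum]
  rw [e, Finset.sum_mul]
  refine norm_sum_le_of_le _ fun j _ => ?_
  rw [norm_smul, mul_comm]
  gcongr
  exact norm_le_pi_norm v j

/-- **Integration by parts mixing a functional and one generalized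
Fourier–Feynman transform, finite-dimensional form.** With `G̃ = Ψ_{q₁} g`
(Fresnel transform with parameters `τⱼ`), under the stated hypotheses:
`∑ⱼ cⱼ ∫ [f·∂ⱼG̃ + ∂ⱼf·G̃]·E_{q₂} = −iq₂ ∑ⱼ (cⱼ/σⱼ²) ∫ uⱼ·f·G̃·E_{q₂}`,
where `E_{q₂}(u) = exp((iq₂/2) ∑ u_k²/σ_k²)`, all integrals converging
absolutely. -/
theorem parts_formula_functional_and_transform
    (n : ℕ) (hn : 1 ≤ n) (σ τ : Fin n → ℝ) (hσ : ∀ j, 0 < σ j) (hτ : ∀ j, 0 < τ j)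
    (q₁ q₂ : ℝ) (hq₁ : q₁ ≠ 0) (hq₂ : q₂ ≠ 0) (c : Fin n → ℝ)
    (f g : (Fin n → ℝ) → ℂ) (hf : ContDiff ℝ 1 f) (hg : ContDiff ℝ 1 g)
    (hfbdd : ∃ C : ℝ, ∀ u : Fin n → ℝ, ‖f u‖ ≤ C)
    (hdfbdd : ∃ C : ℝ, ∀ (u : Fin n → ℝ) (j : Fin n),
      ‖fderiv ℝ f u (Pi.single j 1)‖ ≤ C)
    (hf1 : Integrable f volume)
    (hdf1 : ∀ j : Fin n,
      Integrable (fun u : Fin n → ℝ => fderiv ℝ f u (Pi.single j 1)) volume)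
    (hg1 : Integrable g volume)
    (hdg1 : ∀ j : Fin n,
      Integrable (fun u : Fin n → ℝ => fderiv ℝ g u (Pi.single j 1)) volume)
    (hu : ∀ j : Fin n,
      Integrable
        (fun u : Fin n → ℝ => (u j : ℂ) * f u * fresnelTransform n τ q₁ g u)
        volume) :
    (∀ j : Fin n,
      Integrable
        (fun u : Fin n → ℝ =>
          (f u * fderiv ℝ (fresnelTransform n τ q₁ g) u (Pi.single j 1) +
            fderiv ℝ f u (Pi.single j 1) * fresnelTransform n τ q₁ g u) *
            Complex.exp (Complex.I * q₂ / 2 * (∑ k, (u k) ^ 2 / (σ k) ^ 2 : ℝ)))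
        volume) ∧
    (∀ j : Fin n,
      Integrable
        (fun u : Fin n → ℝ =>
          (u j : ℂ) * f u * fresnelTransform n τ q₁ g u *
            Complex.exp (Complex.I * q₂ / 2 * (∑ k, (u k) ^ 2 / (σ k) ^ 2 : ℝ)))
        volume) ∧
    ∑ j, (c j : ℂ) *
        ∫ u : Fin n → ℝ,
          (f u * fderiv ℝ (fresnelTransform n τ q₁ g) u (Pi.single j 1) +
            fderiv ℝ f u (Pi.single j 1) * fresnelTransform n τ q₁ g u) *
            Complex.exp (Complex.I * q₂ / 2 * (∑ k, (u k) ^ 2 / (σ k) ^ 2 : ℝ)) =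
      -(Complex.I * q₂) *
        ∑ j, ((c j / (σ j) ^ 2 : ℝ) : ℂ) *
          ∫ u : Fin n → ℝ,
            (u j : ℂ) * f u * fresnelTransform n τ q₁ g u *
              Complex.exp (Complex.I * q₂ / 2 * (∑ k, (u k) ^ 2 / (σ k) ^ 2 : ℝ)) := by
  set G := fresnelTransform n τ q₁ g with hG
  obtain ⟨C, hC⟩ := hfbdd
  have hK := qphase_continuous q₁ τ
  have hK1 := qphase_norm q₁ τ
  have hD := integrable_fderiv_of_partials hg hdg1
  set A : ℂ := ∏ j, (-Complex.I * q₁ / (2 * Real.pi * (τ j) ^ 2)) ^ ((1 : ℂ) / 2) with hA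
  have hGe : G = fun y => A * ctr (qphase q₁ τ) g y := fresnel_eq τ q₁ g
  have hGd : ∀ y, HasFDerivAt G (A • ctr (qphase q₁ τ) (fderiv ℝ g) y) y := by
    intro y
    rw [hGe]
    exact (ctr_hasFDerivAt hK hK1 hg hg1 hD y).const_mul A
  have hGdiff : Differentiable ℝ G := fun y => (hGd y).differentiableAt
  have hGc : Continuous G := hGdiff.continuous
  have hGb : ∀ y, ‖G y‖ ≤ ‖A‖ * ∫ u, ‖g u‖ := by
    intro y
    rw [hGe]
    simp only [norm_mul]
    gcongr
    exact ctr_bound hK1 g y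
  have hG'e : fderiv ℝ G = fun y => A • ctr (qphase q₁ τ) (fderiv ℝ g) y :=
    funext fun y => (hGd y).fderiv
  have hG'c : Continuous (fderiv ℝ G) := by
    rw [hG'e]
    exact (ctr_cont hK hK1 hD).const_smul A
  have hG'b : ∀ y, ‖fderiv ℝ G y‖ ≤ ‖A‖ * ∫ u, ‖fderiv ℝ g u‖ := by
    intro y
    rw [hG'e]
    simp only [norm_smul]
    gcongr
    exact ctr_bound hK1 _ y
  have hEc := qphase_continuous q₂ σ
  have hE1 := qphase_norm q₂ σ
  have mulE : ∀ {k : (Fin n → ℝ) → ℂ}, Integrable k → Integrable (fun u => k u * qphase q₂ σ u) :=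
    fun hk => hk.mul_bdd (c := 1) hEc.aestronglyMeasurable
      (Eventually.of_forall fun u => (hE1 u).le)
  have i1 : ∀ j : Fin n, Integrable (fun u => f u * fderiv ℝ G u (Pi.single j 1)) := by
    intro j
    refine hf1.mul_bdd (c := (‖A‖ * ∫ u, ‖fderiv ℝ g u‖) * ‖(Pi.single j 1 : Fin n → ℝ)‖)
      (hG'c.clm_apply continuous_const).aestronglyMeasurable (Eventually.of_forall fun u => ?_)
    refine (ContinuousLinearMap.le_opNorm _ _).trans ?_
    gcongr
    exact hG'b u
  have i2 : ∀ j : Fin n, Integrable (fun u => fderiv ℝ f u (Pi.single j 1) * G u) := fun j =>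
    (hdf1 j).mul_bdd hGc.aestronglyMeasurable (Eventually.of_forall hGb)
  have i3 : Integrable (fun u => f u * G u) :=
    hf1.mul_bdd hGc.aestronglyMeasurable (Eventually.of_forall hGb)
  have j1 : ∀ j : Fin n, Integrable (fun u => (f u * fderiv ℝ G u (Pi.single j 1) +
      fderiv ℝ f u (Pi.single j 1) * G u) * qphase q₂ σ u) := fun j => mulE ((i1 j).add (i2 j))
  have j2 : ∀ j : Fin n, Integrable (fun u => (u j : ℂ) * f u * G u * qphase q₂ σ u) :=
    fun j => mulE (hu j)
  refine ⟨j1, j2, ?_⟩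
  change ∑ j, (c j : ℂ) * ∫ u, (f u * fderiv ℝ G u (Pi.single j 1) +
      fderiv ℝ f u (Pi.single j 1) * G u) * qphase q₂ σ u = -(Complex.I * q₂) *
        ∑ j, ((c j / (σ j) ^ 2 : ℝ) : ℂ) * ∫ u, (u j : ℂ) * f u * G u * qphase q₂ σ u
  rw [Finset.mul_sum]
  refine Finset.sum_congr rfl fun j _ => ?_
  have hfd := hf.differentiable one_ne_zero
  have d1 : ∀ u, fderiv ℝ (fun u => f u * G u) u (Pi.single j 1)
      = f u * fderiv ℝ G u (Pi.single j 1) + fderiv ℝ f u (Pi.single j 1) * G u := by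
    intro u
    rw [fderiv_fun_mul (hfd u) (hGdiff u)]
    simp
    ring
  have d2 : ∀ u : Fin n → ℝ, f u * G u * fderiv ℝ (qphase q₂ σ) u (Pi.single j 1)
      = (Complex.I * q₂ * ((1 / (σ j) ^ 2 : ℝ) : ℂ)) *
        ((u j : ℂ) * f u * G u * qphase q₂ σ u) := by
    intro u
    rw [qphase_fderiv]
    ring
  have key := integral_mul_fderiv_eq_neg_fderiv_mul_of_integrable (𝕜 := ℂ) (μ := volume)
    (f := fun u => f u * G u) (g := qphase q₂ σ) (v := Pi.single j 1)
    (by simp only [d1]; exact j1 j) (by simp only [d2]; exact (j2 j).const_mul _)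
    (mulE i3) (fun u _ => (hfd u).mul (hGdiff u)) (fun u _ => qphase_differentiable q₂ σ u)
  simp only [d1, d2] at key
  rw [integral_const_mul] at key
  rw [← neg_eq_iff_eq_neg.2 key]
  push_cast
  ring
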